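/- Let P be a pircon, w ∈ P a non-minimal element, and M, N ∈ SPM_w two special partial matchings of w. Then every orbit O of the group ⟨M,N⟩ acting on P_{≤w} is an interval of P: O = {z ∈ P : 0̂_O ≤ z ≤ 1̂_O}, where 0̂_O and 1̂_O are the minimum and the maximum of O. -/

import Mathlib

/-- A special partial matching of the order ideal `P_{≤ w}`, encoded as a total function
`M : P → P` whose values outside `Set.Iic w` are irrelevant. -/
def IsSPMof {P : Type*} [PartialOrder P] (w : P) (M : P → P) : Prop :=
  (∀ x, x ≤ w → M x ≤ w) ∧ (∀ x, x ≤ w → M (M x) = x) ∧ M w ⋖ w ∧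
  (∀ x, x ≤ w → (M x ⋖ x ∨ M x = x ∨ x ⋖ M x)) ∧
  (∀ x y, x ≤ w → y ≤ w → x ⋖ y → M x ≠ y → M x < M y)

/-- A poset is a pircon if, for every non-minimal element `w`, the order ideal `P_{≤ w}`
is finite and admits a special partial matching. -/
def IsPircon (P : Type*) [PartialOrder P] : Prop :=
  ∀ w : P, ¬ IsMin w → (Set.Iic w).Finite ∧ ∃ M : P → P, IsSPMof w M

/-- The orbit of `u` under the group of permutations generated by the two involutions
`M` and `N`: the set of elements reachable from `u` by applying `M` and `N`. -/
def orbitMN {P : Type*} (M N : P → P) (u : P) : Set P :=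
  {v | Relation.ReflTransGen (fun a b => M a = b ∨ N a = b) u v}

/-- Below an element with finite order ideal, the order is generated by the covering relation. -/
theorem reflTransGen_covBy_of_finite_Iic {P : Type*} [PartialOrder P] {x y : P}
    (hy : (Set.Iic y).Finite) (hxy : x ≤ y) : Relation.ReflTransGen (· ⋖ ·) x y := by
  induction hn : (Set.Iic y).ncard using Nat.strong_induction_on generalizing y with
  | _ n ih =>
    subst hn
    rcases hxy.eq_or_lt with rfl | hlt
    · exact .refl
    have hsub : Set.Ico x y ⊆ Set.Iic y := fun _ ha => ha.2.le
    obtain ⟨z, hz⟩ := (hy.subset hsub).exists_maximal ⟨x, le_rfl, hlt⟩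
    have hcov : z ⋖ y := ⟨hz.prop.2, fun a hza hay =>
      hza.not_ge (hz.le_of_ge ⟨hz.prop.1.trans hza.le, hay⟩ hza.le)⟩
    have hss : Set.Iic z ⊂ Set.Iic y := Set.Iic_ssubset_Iic.2 hcov.lt
    exact (ih _ (Set.ncard_lt_ncard hss hy) (hy.subset hss.subset) hz.prop.1 rfl).tail hcov

namespace IsSPMof

variable {P : Type*} [PartialOrder P] {w x y : P} {M : P → P}

/-- Lifting property: the ideal below an element that `M` does not raise is stable under `M`. -/
theorem apply_le (hM : IsSPMof w M) (hw : (Set.Iic w).Finite) (hxy : x ≤ y) (hyw : y ≤ w)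
    (hy : M y ≤ y) : M x ≤ y := by
  obtain ⟨-, -, -, -, hlt⟩ := hM
  have hchain := reflTransGen_covBy_of_finite_Iic (hw.subset (Set.Iic_subset_Iic.2 hyw)) hxy
  clear hxy
  induction hchain using Relation.ReflTransGen.head_induction_on with
  | refl => exact hy
  | @head a c hac hcy ih =>
    have hc : c ≤ y := by
      clear ih hac
      induction hcy using Relation.ReflTransGen.head_induction_on with
      | refl => exact le_rfl
      | head h _ ih => exact h.le.trans ih
    by_cases h : M a = c
    · exact h.trans_le hc
    · exact (hlt a c (hac.le.trans (hc.trans hyw)) (hc.trans hyw) hac h).le.trans ih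

/-- Dual lifting property: the filter above an element that `M` does not lower is stable
under `M`. -/
theorem le_apply (hM : IsSPMof w M) (hw : (Set.Iic w).Finite) (hxy : x ≤ y) (hyw : y ≤ w)
    (hx : x ≤ M x) : x ≤ M y := by
  obtain ⟨-, hinv, -, -, hlt⟩ := hM
  have hchain := reflTransGen_covBy_of_finite_Iic (hw.subset (Set.Iic_subset_Iic.2 hyw)) hxy
  clear hxy
  induction hchain with
  | refl => exact hx
  | @tail c d hxc hcd ih =>
    have hcw : c ≤ w := hcd.le.trans hyw
    have hc : x ≤ c := by
      clear ih hcd hyw hcw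
      induction hxc with
      | refl => exact le_rfl
      | tail _ h ih => exact ih.trans h.le
    by_cases h : M c = d
    · rwa [← h, hinv c hcw]
    · exact (ih hcw).trans (hlt c d hcw hyw hcd h).le

theorem le_apply_or_apply_le (hM : IsSPMof w M) (hx : x ≤ w) : x ≤ M x ∨ M x ≤ x := by
  rcases hM.2.2.2.1 x hx with h | h | h
  · exact .inr h.le
  · exact .inr h.le
  · exact .inl h.le

end IsSPMof

section orbitMN

variable {P : Type*} {M N : P → P} {u v x : P}

theorem self_mem_orbitMN : u ∈ orbitMN M N u := Relation.ReflTransGen.refl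

theorem left_mem_orbitMN (h : x ∈ orbitMN M N u) : M x ∈ orbitMN M N u :=
  Relation.ReflTransGen.tail h (.inl rfl)

theorem right_mem_orbitMN (h : x ∈ orbitMN M N u) : N x ∈ orbitMN M N u :=
  Relation.ReflTransGen.tail h (.inr rfl)

/-- A set stable under `M` and `N` contains the orbits of its elements. -/
theorem orbitMN_subset {s : Set P} (hu : u ∈ s) (hM : ∀ x ∈ s, M x ∈ s) (hN : ∀ x ∈ s, N x ∈ s) :
    orbitMN M N u ⊆ s := by
  intro v hv
  induction hv with
  | refl => exact hu
  | tail _ h ih =>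
    rcases h with rfl | rfl
    · exact hM _ ih
    · exact hN _ ih

theorem orbitMN_subset_orbitMN (h : v ∈ orbitMN M N u) : orbitMN M N v ⊆ orbitMN M N u :=
  fun _ hx => Relation.ReflTransGen.trans h hx

variable [PartialOrder P] {w : P}

theorem orbitMN_subset_Iic (hM : IsSPMof w M) (hN : IsSPMof w N) (hu : u ≤ w) :
    orbitMN M N u ⊆ Set.Iic w :=
  orbitMN_subset hu hM.1 hN.1

theorem mem_orbitMN_symm (hM : IsSPMof w M) (hN : IsSPMof w N) (hu : u ≤ w)
    (hv : v ∈ orbitMN M N u) : u ∈ orbitMN M N v := by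
  refine (orbitMN_subset (s := {x | x ≤ w ∧ u ∈ orbitMN M N x}) ⟨hu, self_mem_orbitMN⟩ ?_ ?_ hv).2
  · rintro x ⟨hx, hux⟩
    exact ⟨hM.1 x hx, Relation.ReflTransGen.head (.inl (hM.2.1 x hx)) hux⟩
  · rintro x ⟨hx, hux⟩
    exact ⟨hN.1 x hx, Relation.ReflTransGen.head (.inr (hN.2.1 x hx)) hux⟩

/-- If neither `M` nor `N` raises `v`, then the orbits of the elements below `v` stay below `v`. -/
theorem orbitMN_subset_Iic_of_apply_le (hM : IsSPMof w M) (hN : IsSPMof w N)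
    (hw : (Set.Iic w).Finite) (hv : v ≤ w) (hMv : M v ≤ v) (hNv : N v ≤ v) (hu : u ≤ v) :
    orbitMN M N u ⊆ Set.Iic v :=
  orbitMN_subset hu (fun _ hx => hM.apply_le hw hx hv hMv) fun _ hx => hN.apply_le hw hx hv hNv

/-- If neither `M` nor `N` lowers `v`, then the orbits of the elements above `v` stay above `v`. -/
theorem orbitMN_subset_Ici_of_le_apply (hM : IsSPMof w M) (hN : IsSPMof w N)
    (hw : (Set.Iic w).Finite) (hMv : v ≤ M v) (hNv : v ≤ N v) (hu : v ≤ u) (huw : u ≤ w) :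
    orbitMN M N u ⊆ Set.Ici v := by
  have h : orbitMN M N u ⊆ {x | x ≤ w ∧ v ≤ x} :=
    orbitMN_subset ⟨huw, hu⟩ (fun x hx => ⟨hM.1 x hx.1, hM.le_apply hw hx.2 hx.1 hMv⟩)
      fun x hx => ⟨hN.1 x hx.1, hN.le_apply hw hx.2 hx.1 hNv⟩
  exact fun x hx => (h hx).2

theorem exists_mem_orbitMN_apply_le (hM : IsSPMof w M) (hN : IsSPMof w N)
    (hw : (Set.Iic w).Finite) (hu : u ≤ w) : ∃ t ∈ orbitMN M N u, M t ≤ t ∧ N t ≤ t := by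
  have hsub := orbitMN_subset_Iic hM hN hu
  obtain ⟨t, ht⟩ := (hw.subset hsub).exists_maximal ⟨u, self_mem_orbitMN⟩
  exact ⟨t, ht.prop,
    (hM.le_apply_or_apply_le (hsub ht.prop)).elim (ht.le_of_ge (left_mem_orbitMN ht.prop)) id,
    (hN.le_apply_or_apply_le (hsub ht.prop)).elim (ht.le_of_ge (right_mem_orbitMN ht.prop)) id⟩

theorem exists_mem_orbitMN_le_apply (hM : IsSPMof w M) (hN : IsSPMof w N)
    (hw : (Set.Iic w).Finite) (hu : u ≤ w) : ∃ b ∈ orbitMN M N u, b ≤ M b ∧ b ≤ N b := by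
  have hsub := orbitMN_subset_Iic hM hN hu
  obtain ⟨b, hb⟩ := (hw.subset hsub).exists_minimal ⟨u, self_mem_orbitMN⟩
  exact ⟨b, hb.prop,
    (hM.le_apply_or_apply_le (hsub hb.prop)).elim id (hb.le_of_le (left_mem_orbitMN hb.prop)),
    (hN.le_apply_or_apply_le (hsub hb.prop)).elim id (hb.le_of_le (right_mem_orbitMN hb.prop))⟩

end orbitMN

/-- Let `P` be a pircon, `w ∈ P` non-minimal, and `M, N ∈ SPM_w`.
Then every orbit `O` of `⟨M,N⟩` acting on `P_{≤ w}` is an interval of `P`: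
`O = {z ∈ P : 0̂_O ≤ z ≤ 1̂_O}` where `0̂_O, 1̂_O` are the minimum and maximum of `O`. -/
theorem stmt4 {P : Type*} [PartialOrder P] (hP : IsPircon P)
    (w : P) (hw : ¬ IsMin w) (M N : P → P)
    (hM : IsSPMof w M) (hN : IsSPMof w N)
    (u : P) (hu : u ≤ w) :
    ∃ b ∈ orbitMN M N u, ∃ t ∈ orbitMN M N u,
      (∀ z ∈ orbitMN M N u, b ≤ z ∧ z ≤ t) ∧
      orbitMN M N u = Set.Icc b t := by
  have hfin := (hP w hw).1
  obtain ⟨b, hb, hMb, hNb⟩ := exists_mem_orbitMN_le_apply hM hN hfin hu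
  obtain ⟨t, ht, hMt, hNt⟩ := exists_mem_orbitMN_apply_le hM hN hfin hu
  have hbw : b ≤ w := orbitMN_subset_Iic hM hN hu hb
  have htw : t ≤ w := orbitMN_subset_Iic hM hN hu ht
  have hub : orbitMN M N u ⊆ orbitMN M N b :=
    orbitMN_subset_orbitMN (mem_orbitMN_symm hM hN hu hb)
  have hut : orbitMN M N u ⊆ orbitMN M N t :=
    orbitMN_subset_orbitMN (mem_orbitMN_symm hM hN hu ht)
  have hbounds : ∀ z ∈ orbitMN M N u, b ≤ z ∧ z ≤ t := fun z hz =>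
    ⟨orbitMN_subset_Ici_of_le_apply hM hN hfin hMb hNb le_rfl hbw (hub hz),
      orbitMN_subset_Iic_of_apply_le hM hN hfin htw hMt hNt le_rfl (hut hz)⟩
  refine ⟨b, hb, t, ht, hbounds, Set.Subset.antisymm hbounds ?_⟩
  rintro z ⟨hbz, hzt⟩
  have hzw : z ≤ w := hzt.trans htw
  obtain ⟨b', hb', hMb', hNb'⟩ := exists_mem_orbitMN_le_apply hM hN hfin hzw
  have hbb' : b ≤ b' := orbitMN_subset_Ici_of_le_apply hM hN hfin hMb hNb hbz hzw hb'
  have hb't : b' ≤ t := orbitMN_subset_Iic_of_apply_le hM hN hfin htw hMt hNt hzt hb'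
  have hb'b : b' ≤ b := orbitMN_subset_Ici_of_le_apply hM hN hfin hMb' hNb' hb't htw (hut hb)
  obtain rfl : b = b' := hbb'.antisymm hb'b
  exact orbitMN_subset_orbitMN hb (mem_orbitMN_symm hM hN hzw hb')
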